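/- Every nonnegative integer n can be written as n = p₆(x₁) + p₆(x₂) + 2·p₆(x₃) + 4·p₆(x₄) with x₁, x₂, x₃, x₄ nonnegative integers. -/

import Mathlib

/-! ### Reduction of binary and ternary forms -/

lemma exists_round (A B : ℤ) (hA : 0 < A) : ∃ k : ℤ, 4 * (B + k * A) ^ 2 ≤ A ^ 2 := by
  refine ⟨-((2 * B + A) / (2 * A)), ?_⟩
  have h1 := Int.emod_nonneg (2 * B + A) (show (2 * A) ≠ 0 by omega)
  have h2 := Int.emod_lt_of_pos (2 * B + A) (show 0 < 2 * A by omega)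
  have h3 := Int.emod_add_mul_ediv (2 * B + A) (2 * A)
  set q := (2 * B + A) / (2 * A)
  set r := (2 * B + A) % (2 * A)
  have h4 : 2 * (B + -q * A) = r - A := by linear_combination -h3
  have h5 : 4 * (B + -q * A) ^ 2 = (r - A) ^ 2 := by rw [← h4]; ring
  rw [h5]
  nlinarith

lemma binary_reduce (m : ℕ) : ∀ A B C : ℤ, A.toNat = m → 0 < A → 0 < A * C - B ^ 2 →
    ∃ p q r s : ℤ, p * s - q * r = 1 ∧ 0 < A * p ^ 2 + 2 * B * p * r + C * r ^ 2 ∧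
      3 * (A * p ^ 2 + 2 * B * p * r + C * r ^ 2) ^ 2 ≤ 4 * (A * C - B ^ 2) := by
  induction m using Nat.strong_induction_on with
  | _ m ih =>
    intro A B C hm hA hD
    obtain ⟨k, hk⟩ := exists_round A B hA
    set C0 := A * k ^ 2 + 2 * B * k + C with hC0
    have hdet : A * C0 - (B + k * A) ^ 2 = A * C - B ^ 2 := by rw [hC0]; ring
    have hC0pos : 0 < C0 := by
      have : 0 < A * C0 := by nlinarith [sq_nonneg (B + k * A)]
      exact pos_of_mul_pos_right this hA.le
    by_cases hlt : C0 < A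
    · obtain ⟨p, q, r, s, h1, h2, h3⟩ := ih C0.toNat (by omega) C0 (-(B + k * A)) A rfl hC0pos
        (by nlinarith)
      have e : A * (k * p - r) ^ 2 + 2 * B * (k * p - r) * p + C * p ^ 2
          = C0 * p ^ 2 + 2 * -(B + k * A) * p * r + A * r ^ 2 := by rw [hC0]; ring
      refine ⟨k * p - r, k * q - s, p, q, by linear_combination h1, ?_, ?_⟩
      · rw [e]; exact h2
      · rw [e]; refine h3.trans (le_of_eq ?_); linear_combination 4 * hdet
    · refine ⟨1, 0, 0, 1, by ring, by simpa using hA, ?_⟩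
      push Not at hlt
      have : A * A ≤ A * C0 := mul_le_mul_of_nonneg_left hlt hA.le
      have e : A * 1 ^ 2 + 2 * B * 1 * 0 + C * 0 ^ 2 = A := by ring
      rw [e]
      nlinarith

lemma binary_det_one (A B C : ℤ) (hA : 0 < A) (hD : A * C - B ^ 2 = 1) (y z : ℤ) :
    ∃ u v : ℤ, A * y ^ 2 + 2 * B * y * z + C * z ^ 2 = u ^ 2 + v ^ 2 := by
  obtain ⟨p, q, r, s, h1, h2, h3⟩ := binary_reduce _ A B C rfl hA (by omega)
  have hA' : A * p ^ 2 + 2 * B * p * r + C * r ^ 2 = 1 := by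
    rw [hD] at h3
    nlinarith
  set B' := A * p * q + B * (p * s + q * r) + C * r * s with hB'
  set C' := A * q ^ 2 + 2 * B * q * s + C * s ^ 2 with hC'
  have hd : C' - B' ^ 2 = 1 := by
    have : (A * p ^ 2 + 2 * B * p * r + C * r ^ 2) * C' - B' ^ 2
        = (A * C - B ^ 2) * (p * s - q * r) ^ 2 := by rw [hB', hC']; ring
    rw [hA', h1, hD] at this
    linarith
  obtain ⟨Y, hY⟩ : ∃ Y, Y = s * y - q * z := ⟨_, rfl⟩
  obtain ⟨Z, hZ⟩ : ∃ Z, Z = -r * y + p * z := ⟨_, rfl⟩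
  have hy : y = p * Y + q * Z := by rw [hY, hZ]; linear_combination -y * h1
  have hz : z = r * Y + s * Z := by rw [hY, hZ]; linear_combination -z * h1
  refine ⟨Y + B' * Z, Z, ?_⟩
  have e : A * y ^ 2 + 2 * B * y * z + C * z ^ 2
      = (A * p ^ 2 + 2 * B * p * r + C * r ^ 2) * Y ^ 2 + 2 * B' * Y * Z + C' * Z ^ 2 := by
    rw [hy, hz, hB', hC']; ring
  rw [e, hA']
  linear_combination Z ^ 2 * hd

lemma ternary_det_one (m : ℕ) : ∀ a b c d e f : ℤ, a.toNat = m → 0 < a → 0 < a * b - f ^ 2 →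
    a * b * c + 2 * d * e * f - a * d ^ 2 - b * e ^ 2 - c * f ^ 2 = 1 →
    ∀ x y z : ℤ, ∃ u v w : ℤ,
      a * x ^ 2 + b * y ^ 2 + c * z ^ 2 + 2 * d * y * z + 2 * e * x * z + 2 * f * x * y
        = u ^ 2 + v ^ 2 + w ^ 2 := by
  induction m using Nat.strong_induction_on with
  | _ m ih =>
    intro a b c d e f hm ha hab hdet x y z
    have hg : (a * b - f ^ 2) * (a * c - e ^ 2) - (a * d - e * f) ^ 2 = a := by
      linear_combination a * hdet
    obtain ⟨p, q, r, s, h1, h2, h3⟩ :=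
      binary_reduce _ (a * b - f ^ 2) (a * d - e * f) (a * c - e ^ 2) rfl hab (by omega)
    rw [hg] at h3
    obtain ⟨k, hk⟩ := exists_round a (f * p + e * r) ha
    set A' := (a * b - f ^ 2) * p ^ 2 + 2 * (a * d - e * f) * p * r + (a * c - e ^ 2) * r ^ 2
      with hA'
    obtain ⟨f2, hf2⟩ : ∃ t, t = f * p + e * r + k * a := ⟨_, rfl⟩
    obtain ⟨b2, hb2⟩ : ∃ t, t = b * p ^ 2 + 2 * d * p * r + c * r ^ 2
      + 2 * k * (f * p + e * r) + k ^ 2 * a := ⟨_, rfl⟩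
    rw [← hf2] at hk
    have hab2 : a * b2 - f2 ^ 2 = A' := by rw [hf2, hb2, hA']; ring
    have hb2pos : 0 < b2 := by
      have : 0 < a * b2 := by nlinarith [sq_nonneg f2]
      exact pos_of_mul_pos_right this ha.le
    by_cases hlt : b2 < a
    · have key := ih b2.toNat (by omega) b2 a (c * s ^ 2 + 2 * d * q * s + b * q ^ 2)
        (f * q + e * s)
        (k * (f * q + e * s) + (b * p * q + d * (p * s + q * r) + c * r * s)) f2 rfl hb2pos
        (by linarith)
        (by
          have : (a * b * c + 2 * d * e * f - a * d ^ 2 - b * e ^ 2 - c * f ^ 2)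
            * (p * s - q * r) ^ 2 = 1 := by rw [hdet, h1]; norm_num
          rw [← this, hf2, hb2]; ring)
        (s * y - q * z) (x - k * (s * y - q * z)) (-r * y + p * z)
      obtain ⟨u, v, w, h⟩ := key
      refine ⟨u, v, w, ?_⟩
      rw [← h]
      obtain ⟨Y, hY⟩ : ∃ Y, Y = s * y - q * z := ⟨_, rfl⟩
      obtain ⟨Z, hZ⟩ : ∃ Z, Z = -r * y + p * z := ⟨_, rfl⟩
      have hy : y = p * Y + q * Z := by rw [hY, hZ]; linear_combination -y * h1
      have hz : z = r * Y + s * Z := by rw [hY, hZ]; linear_combination -z * h1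
      rw [← hY, ← hZ, hy, hz, hf2, hb2]
      ring
    · push Not at hlt
      have h4 : a * a ≤ a * b2 := mul_le_mul_of_nonneg_left hlt ha.le
      have h5 : 3 * a ^ 2 ≤ 4 * A' := by nlinarith
      have ha1 : a = 1 := by
        by_contra hne
        have h2a : 2 ≤ a := by omega
        have h6 : (3 * a ^ 2) ^ 2 ≤ (4 * A') ^ 2 := pow_le_pow_left₀ (by positivity) h5 2
        have h7 : 27 * a ^ 3 * a ≤ 64 * a := by nlinarith
        have h8 : 27 * a ^ 3 ≤ 64 := le_of_mul_le_mul_right h7 ha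
        have h9 : (2 : ℤ) ^ 3 ≤ a ^ 3 := pow_le_pow_left₀ (by norm_num) h2a 3
        linarith
      subst ha1
      obtain ⟨u, v, huv⟩ := binary_det_one (b - f ^ 2) (d - e * f) (c - e ^ 2) (by linarith)
        (by linear_combination hdet) y z
      refine ⟨x + f * y + e * z, u, v, ?_⟩
      linear_combination huv

/-! ### Three squares for numbers congruent to 2 mod 4 -/

lemma three_squares_nat (n : ℕ) (hn : n % 4 = 2) :
    ∃ u v w : ℤ, (n : ℤ) = u ^ 2 + v ^ 2 + w ^ 2 := by
  have hcop : (n - 1).Coprime (4 * n) := by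
    have h1 : (n - 1).Coprime n := by
      have : n = (n - 1) + 1 := by omega
      conv_rhs => rw [this]
      simp
    have h2 : (n - 1).Coprime 2 := by
      rw [Nat.coprime_comm, Nat.coprime_two_left, Nat.odd_iff]; omega
    have h3 : (n - 1).Coprime 4 := by
      have := h2.pow_right 2
      simpa using this
    exact h3.mul_right h1
  obtain ⟨p, hpn, hpp, hmod⟩ :=
    Nat.forall_exists_prime_gt_and_modEq (4 * n) (q := 4 * n) (a := n - 1) (by omega) hcop
  obtain ⟨j, hj⟩ : 4 * n ∣ p - (n - 1) := (Nat.modEq_iff_dvd' (by omega)).mp hmod.symm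
  have hp : p + 1 = (4 * j + 1) * n := by
    have : p = 4 * n * j + (n - 1) := by omega
    have h2 : 4 * n * j + n = (4 * j + 1) * n := by ring
    omega
  have : Fact p.Prime := ⟨hpp⟩
  have hp4 : p % 4 = 1 := by
    have : p = 4 * (n * j) + (n - 1) := by rw [← mul_assoc]; omega
    omega
  have hpodd : Odd p := by rw [Nat.odd_iff]; omega
  have hdodd : Odd (4 * j + 1) := by rw [Nat.odd_iff]; omega
  have hJ : jacobiSym (-((4 * j + 1 : ℕ) : ℤ)) p = 1 := by
    rw [jacobiSym.neg _ hpodd, ZMod.χ₄_nat_one_mod_four hp4, one_mul,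
      jacobiSym.quadratic_reciprocity_one_mod_four (by omega) hpodd]
    have : jacobiSym (p : ℤ) (4 * j + 1) = jacobiSym (-1) (4 * j + 1) := by
      apply jacobiSym.mod_left'
      apply Int.ModEq.symm
      rw [Int.modEq_iff_dvd]
      refine ⟨n, ?_⟩
      have : (p : ℤ) + 1 = ((4 * j + 1 : ℕ) : ℤ) * n := by exact_mod_cast hp
      linarith
    rw [this, jacobiSym.at_neg_one hdodd, ZMod.χ₄_nat_one_mod_four (by omega)]
  have hsq := ZMod.isSquare_of_jacobiSym_eq_one hJ
  obtain ⟨t', ht'⟩ := hsq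
  obtain ⟨t, rfl⟩ := ZMod.intCast_surjective t'
  have hdvd : (p : ℤ) ∣ t ^ 2 + (4 * j + 1) := by
    rw [← ZMod.intCast_zmod_eq_zero_iff_dvd]
    push_cast
    push_cast at ht'
    linear_combination -ht'
  obtain ⟨a, ha⟩ := hdvd
  have hpZ : (p : ℤ) + 1 = (4 * j + 1) * n := by exact_mod_cast hp
  have hppos : (0 : ℤ) < p := by exact_mod_cast hpp.pos
  have hapos : 0 < a := by
    have : 0 < (p : ℤ) * a := by rw [← ha]; positivity
    exact pos_of_mul_pos_right this hppos.le
  obtain ⟨u, v, w, h⟩ := ternary_det_one _ a p n 0 1 t rfl hapos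
    (by have : a * p - t ^ 2 = 4 * j + 1 := by linear_combination -ha
        rw [this]; positivity)
    (by linear_combination -(n : ℤ) * ha - hpZ) 0 0 1
  exact ⟨u, v, w, by rw [← h]; ring⟩

lemma three_squares (n : ℤ) (hpos : 0 < n) (hn : n % 4 = 2) :
    ∃ u v w : ℤ, n = u ^ 2 + v ^ 2 + w ^ 2 := by
  obtain ⟨u, v, w, h⟩ := three_squares_nat n.toNat (by omega)
  exact ⟨u, v, w, by rw [← h]; omega⟩

lemma sq_mod_four (x : ℤ) : (x % 2 = 0 ∧ x ^ 2 % 4 = 0) ∨ (x % 2 = 1 ∧ x ^ 2 % 8 = 1) := by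
  rcases Int.even_or_odd' x with ⟨k, rfl | rfl⟩
  · left
    refine ⟨by omega, ?_⟩
    have : (2 * k) ^ 2 = 4 * k ^ 2 := by ring
    omega
  · right
    refine ⟨by omega, ?_⟩
    have h : (2 * k + 1) ^ 2 = 4 * (k * (k + 1)) + 1 := by ring
    obtain ⟨l, hl⟩ := Int.even_mul_succ_self k
    omega

/-- Three squares, normalised: two odd, one even. -/
lemma three_squares' (n : ℤ) (hpos : 0 < n) (hn : n % 4 = 2) :
    ∃ u v w : ℤ, n = u ^ 2 + v ^ 2 + w ^ 2 ∧ u % 2 = 1 ∧ v % 2 = 1 ∧ w % 2 = 0 := by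
  obtain ⟨u, v, w, h⟩ := three_squares n hpos hn
  rcases sq_mod_four u with hu | hu <;> rcases sq_mod_four v with hv | hv <;>
    rcases sq_mod_four w with hw | hw <;> try omega
  · exact ⟨v, w, u, by linarith, by omega, by omega, by omega⟩
  · exact ⟨u, w, v, by linarith, by omega, by omega, by omega⟩
  · exact ⟨u, v, w, by linarith, by omega, by omega, by omega⟩

/-- Odd positive integers are `u² + 2v² + 4w²`. -/
lemma odd_rep (N : ℤ) (hpos : 0 < N) (hN : N % 2 = 1) :
    ∃ u v w : ℤ, N = u ^ 2 + 2 * v ^ 2 + 4 * w ^ 2 := by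
  obtain ⟨p, q, r, h, hp, hq, hr⟩ := three_squares' (2 * N) (by omega) (by omega)
  obtain ⟨s, rfl⟩ : ∃ s, p = q + 2 * s := ⟨(p - q) / 2, by omega⟩
  obtain ⟨v, rfl⟩ : ∃ v, r = 2 * v := ⟨r / 2, by omega⟩
  have h1 : N = (q + s) ^ 2 + s ^ 2 + 2 * v ^ 2 := by linarith
  rcases Int.even_or_odd' s with ⟨w, hw | hw⟩
  · exact ⟨q + s, v, w, by rw [h1, hw]; ring⟩
  · obtain ⟨w', hw'⟩ : ∃ w', q + s = 2 * w' := ⟨(q + s) / 2, by omega⟩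
    exact ⟨s, v, w', by rw [h1, hw']; ring⟩

/-! ### The Cauchy-type argument -/

lemma hex_cast (x : ℤ) (hx : 0 ≤ x) :
    ((x.toNat * (2 * x.toNat - 1) : ℕ) : ℤ) = 2 * x ^ 2 - x := by
  obtain ⟨k, rfl⟩ := Int.eq_ofNat_of_zero_le hx
  rcases k with _ | k
  · simp
  · have : 2 * (k + 1) - 1 = 2 * k + 1 := by omega
    simp only [Int.toNat_natCast, this]
    push_cast
    ring

lemma finish (n : ℕ) (a b x₁ x₂ x₃ x₄ : ℤ) (hn : (n : ℤ) = 2 * a - b)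
    (hb : b = x₁ + x₂ + 2 * x₃ + 4 * x₄) (ha : a = x₁ ^ 2 + x₂ ^ 2 + 2 * x₃ ^ 2 + 4 * x₄ ^ 2)
    (hb0 : 0 ≤ b) (hlow : 7 * (a - 1) < (b + 1) ^ 2) :
    ∃ x₁ x₂ x₃ x₄ : ℕ,
      n = x₁ * (2 * x₁ - 1) + x₂ * (2 * x₂ - 1)
          + 2 * (x₃ * (2 * x₃ - 1)) + 4 * (x₄ * (2 * x₄ - 1)) := by
  have h1 : 0 ≤ x₁ := by
    by_contra hneg
    push Not at hneg
    have : (b - x₁) ^ 2 ≤ 7 * (a - x₁ ^ 2) := by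
      rw [hb, ha]
      nlinarith [sq_nonneg (x₂ - x₃), sq_nonneg (x₂ - x₄), sq_nonneg (x₃ - x₄)]
    nlinarith
  have h2 : 0 ≤ x₂ := by
    by_contra hneg
    push Not at hneg
    have : (b - x₂) ^ 2 ≤ 7 * (a - x₂ ^ 2) := by
      rw [hb, ha]
      nlinarith [sq_nonneg (x₁ - x₃), sq_nonneg (x₁ - x₄), sq_nonneg (x₃ - x₄)]
    nlinarith
  have h3 : 0 ≤ x₃ := by
    by_contra hneg
    push Not at hneg
    have : (b - 2 * x₃) ^ 2 ≤ 6 * (a - 2 * x₃ ^ 2) := by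
      rw [hb, ha]
      nlinarith [sq_nonneg (x₁ - x₂), sq_nonneg (x₁ - x₄), sq_nonneg (x₂ - x₄)]
    have ha1 : 0 ≤ a := by rw [ha]; positivity
    nlinarith
  have h4 : 0 ≤ x₄ := by
    by_contra hneg
    push Not at hneg
    have : (b - 4 * x₄) ^ 2 ≤ 4 * (a - 4 * x₄ ^ 2) := by
      rw [hb, ha]
      nlinarith [sq_nonneg (x₁ - x₂), sq_nonneg (x₁ - x₃), sq_nonneg (x₂ - x₃)]
    have ha1 : 0 ≤ a := by rw [ha]; positivity
    nlinarith
  refine ⟨x₁.toNat, x₂.toNat, x₃.toNat, x₄.toNat, ?_⟩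
  zify
  have e1 := hex_cast x₁ h1
  have e2 := hex_cast x₂ h2
  have e3 := hex_cast x₃ h3
  have e4 := hex_cast x₄ h4
  rw [Nat.cast_mul] at e1 e2 e3 e4
  rw [e1, e2, e3, e4, hn, ha, hb]
  ring

lemma core (n : ℕ) (a b u v w : ℤ) (hn : (n : ℤ) = 2 * a - b)
    (h : 8 * a - b ^ 2 = u ^ 2 + 2 * v ^ 2 + 4 * w ^ 2)
    (hu : (b - u) % 8 = 0) (hv : ((b + u) / 2 - v) % 4 = 0)
    (hw : (((b + u) / 2 + v) / 2 + w) % 2 = 0)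
    (hb0 : 0 ≤ b) (hlow : 7 * (a - 1) < (b + 1) ^ 2) :
    ∃ x₁ x₂ x₃ x₄ : ℕ,
      n = x₁ * (2 * x₁ - 1) + x₂ * (2 * x₂ - 1)
          + 2 * (x₃ * (2 * x₃ - 1)) + 4 * (x₄ * (2 * x₄ - 1)) := by
  obtain ⟨x₄, h4⟩ : ∃ t, u = b - 8 * t := ⟨(b - u) / 8, by omega⟩
  obtain ⟨x₃, h3⟩ : ∃ t, v = b - 4 * x₄ - 4 * t := ⟨(b - 4 * x₄ - v) / 4, by omega⟩
  obtain ⟨x₂, h2⟩ : ∃ t, w = b - 4 * x₄ - 2 * x₃ - 2 * t :=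
    ⟨(b - 4 * x₄ - 2 * x₃ - w) / 2, by omega⟩
  refine finish n a b (b - 4 * x₄ - 2 * x₃ - x₂) x₂ x₃ x₄ hn (by ring) ?_ hb0 hlow
  rw [h4, h3, h2] at h
  linarith

lemma exists_window (n : ℕ) (hn : 100000 ≤ n) (r : ℤ) :
    ∃ b : ℤ, (b - r) % 32 = 0 ∧ 0 < b ∧ b ^ 2 ≤ 4 * n ∧ 7 * (n : ℤ) < 2 * b ^ 2 - 3 * b + 16 := by
  obtain ⟨t, ht⟩ : ∃ t : ℤ, t = (Nat.sqrt (4 * n) : ℤ) := ⟨_, rfl⟩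
  have h1 : t ^ 2 ≤ 4 * n := by rw [ht]; exact_mod_cast Nat.sqrt_le' (4 * n)
  have h2 : 4 * (n : ℤ) < (t + 1) ^ 2 := by rw [ht]; exact_mod_cast Nat.lt_succ_sqrt' (4 * n)
  have ht0 : 0 ≤ t := by rw [ht]; positivity
  have h3 : 600 ≤ t := by
    have : (100000 : ℤ) ≤ n := by exact_mod_cast hn
    nlinarith
  refine ⟨t - (t - r) % 32, by omega, by omega, ?_, ?_⟩
  · have : t - (t - r) % 32 ≤ t := by omega
    nlinarith [show 0 ≤ t - (t - r) % 32 by omega]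
  · obtain ⟨b, hb⟩ : ∃ b, b = t - (t - r) % 32 := ⟨_, rfl⟩
    have : t - 31 ≤ b := by omega
    rw [← hb]
    nlinarith

lemma large_case (n : ℕ) (hn : 100000 ≤ n) :
    ∃ x₁ x₂ x₃ x₄ : ℕ,
      n = x₁ * (2 * x₁ - 1) + x₂ * (2 * x₂ - 1)
          + 2 * (x₃ * (2 * x₃ - 1)) + 4 * (x₄ * (2 * x₄ - 1)) := by
  have hcases : n % 2 = 1 ∨ n % 4 = 2 ∨ n % 8 = 4 ∨ n % 8 = 0 := by omega
  rcases hcases with h | h | h | h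
  · -- n odd
    obtain ⟨b, hbr, hb0, hup, hlow⟩ := exists_window n hn (2 - n)
    obtain ⟨a, ha⟩ : ∃ a : ℤ, (n : ℤ) = 2 * a - b := ⟨(n + b) / 2, by omega⟩
    have hlow' : 7 * (a - 1) < (b + 1) ^ 2 := by nlinarith
    have hbo := sq_mod_four b
    obtain ⟨u, v, w, huvw⟩ := odd_rep (8 * a - b ^ 2) (by nlinarith) (by omega)
    have hu := sq_mod_four u
    have hv := sq_mod_four v
    have hw := sq_mod_four w
    have hvo : v % 2 = 1 := by omega
    have hwo : w % 2 = 1 := by omega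
    -- mod 16 information
    have hub : (b - u) % 8 = 0 ∨ (b + u) % 8 = 0 := by
      obtain ⟨s, hs⟩ : ∃ s, u = b + 2 * s := ⟨(u - b) / 2, by omega⟩
      have e1 : u ^ 2 = b ^ 2 + 4 * (s * (s + b)) := by rw [hs]; ring
      have e2 : (s * (s + b)) % 4 = 0 := by omega
      have hb4 : b % 4 = 1 ∨ b % 4 = 3 := by omega
      have hs4 : s % 4 = 0 ∨ s % 4 = 1 ∨ s % 4 = 2 ∨ s % 4 = 3 := by omega
      rw [Int.mul_emod, Int.add_emod] at e2
      rcases hb4 with hb4 | hb4 <;> rcases hs4 with hs4 | hs4 | hs4 | hs4 <;>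
        rw [hb4, hs4] at e2 <;> norm_num at e2 <;> omega
    obtain ⟨u', hu', hbu⟩ : ∃ u', u' ^ 2 = u ^ 2 ∧ (b - u') % 8 = 0 := by
      rcases hub with h | h
      · exact ⟨u, rfl, h⟩
      · exact ⟨-u, by ring, by omega⟩
    obtain ⟨v', hv', hbv⟩ : ∃ v', v' ^ 2 = v ^ 2 ∧ ((b + u') / 2 - v') % 4 = 0 := by
      by_cases hh : ((b + u') / 2 - v) % 4 = 0
      · exact ⟨v, rfl, hh⟩
      · exact ⟨-v, by ring, by omega⟩
    exact core n a b u' v' w ha (by rw [hu', hv']; exact huvw) hbu hbv (by omega) hb0.le hlow'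
  · -- n = 2 mod 4
    obtain ⟨b, hbr, hb0, hup, hlow⟩ := exists_window n hn 2
    obtain ⟨c, rfl⟩ : ∃ c, b = 2 * c := ⟨b / 2, by omega⟩
    obtain ⟨a, ha⟩ : ∃ a : ℤ, (n : ℤ) = 2 * a - 2 * c := ⟨(n + 2 * c) / 2, by omega⟩
    have hlow' : 7 * (a - 1) < (2 * c + 1) ^ 2 := by nlinarith
    have hbo := sq_mod_four c
    obtain ⟨u, v, w, huvw⟩ := odd_rep (2 * a - c ^ 2) (by nlinarith) (by omega)
    have hu := sq_mod_four u
    have hv := sq_mod_four v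
    have hvo : v % 2 = 1 := by omega
    obtain ⟨u', hu', hbu⟩ : ∃ u', u' ^ 2 = u ^ 2 ∧ (c - u') % 4 = 0 := by
      by_cases hh : (c - u) % 4 = 0
      · exact ⟨u, rfl, hh⟩
      · exact ⟨-u, by ring, by omega⟩
    exact core n a (2 * c) (2 * u') (2 * v) (2 * w) ha (by linear_combination 4 * huvw - 4 * hu')
      (by omega) (by omega) (by omega) hb0.le hlow'
  · -- n = 4 mod 8
    obtain ⟨b, hbr, hb0, hup, hlow⟩ := exists_window n hn 0
    obtain ⟨c, rfl⟩ : ∃ c, b = 8 * c := ⟨b / 8, by omega⟩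
    obtain ⟨a, ha⟩ : ∃ a : ℤ, (n : ℤ) = 2 * (2 * a) - 8 * c := ⟨(n + 8 * c) / 4, by omega⟩
    obtain ⟨u, v, w, huvw⟩ := odd_rep (a - (2 * c) ^ 2) (by nlinarith)
      (by have : (2 * c) ^ 2 = 4 * c ^ 2 := by ring
          omega)
    exact core n (2 * a) (8 * c) (4 * (2 * w)) (4 * v) (2 * u) ha
      (by linear_combination 16 * huvw) (by omega) (by omega) (by omega) hb0.le (by nlinarith)
  · -- n = 0 mod 8
    obtain ⟨r, hr⟩ : ∃ r : ℤ, ((n : ℤ) / 4 + r - r ^ 2) % 8 = 4 := by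
      have : (n : ℤ) / 4 % 8 = 0 ∨ (n : ℤ) / 4 % 8 = 2 ∨ (n : ℤ) / 4 % 8 = 4
        ∨ (n : ℤ) / 4 % 8 = 6 := by omega
      rcases this with h | h | h | h
      · exact ⟨4, by omega⟩
      · exact ⟨6, by omega⟩
      · exact ⟨0, by omega⟩
      · exact ⟨2, by omega⟩
    obtain ⟨b, hbr, hb0, hup, hlow⟩ := exists_window n hn (4 * r)
    obtain ⟨k, hk⟩ : ∃ k, b = 4 * (r + 8 * k) := ⟨(b - 4 * r) / 32, by omega⟩
    obtain ⟨c, hc⟩ : ∃ c, c = r + 8 * k := ⟨_, rfl⟩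
    rw [← hc] at hk
    subst hk
    obtain ⟨a, ha⟩ : ∃ a : ℤ, (n : ℤ) = 2 * (2 * a) - 4 * c := ⟨(n + 4 * c) / 4, by omega⟩
    have hN : (a - c ^ 2) % 8 = 4 := by
      have e1 : c ^ 2 = r ^ 2 + 8 * (2 * r * k + 8 * k ^ 2) := by rw [hc]; ring
      omega
    obtain ⟨M, hM⟩ : ∃ M, a - c ^ 2 = 2 * M := ⟨(a - c ^ 2) / 2, by omega⟩
    obtain ⟨p, q, v, h3, hp, hq, hv⟩ := three_squares' M (by nlinarith) (by omega)
    by_cases hpar : c % 2 = 0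
    · exact core n (2 * a) (4 * c) (4 * (p + q)) (4 * v) (2 * (p - q)) ha
        (by linear_combination 16 * hM + 32 * h3) (by omega) (by omega) (by omega) hb0.le
        (by nlinarith)
    · exact core n (2 * a) (4 * c) (4 * (p + v)) (4 * q) (2 * (p - v)) ha
        (by linear_combination 16 * hM + 32 * h3) (by omega) (by omega) (by omega) hb0.le
        (by nlinarith)

/-! ### The finite check, by bit masks -/

def hexOrAux (k t S : ℕ) : ℕ :=
  Nat.rec 0 (fun i acc => acc ||| (S <<< (k * (i * (2 * i - 1))))) t

/-- Same as `hexOrAux`; the recursion on `S` makes the kernel evaluate `S` first. -/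
def hexOr (S k t : ℕ) : ℕ :=
  Nat.rec (hexOrAux k t 0) (fun j _ => hexOrAux k t (j + 1)) S

lemma hexOr_eq (S k t : ℕ) : hexOr S k t = hexOrAux k t S := by
  cases S <;> rfl

lemma hexOr_spec (S k t i : ℕ) (h : (hexOr S k t).testBit i = true) :
    ∃ x j : ℕ, i = j + k * (x * (2 * x - 1)) ∧ S.testBit j = true := by
  rw [hexOr_eq] at h
  induction t with
  | zero => simp [hexOrAux] at h
  | succ t ih =>
    have e : hexOrAux k (t + 1) S = hexOrAux k t S ||| (S <<< (k * (t * (2 * t - 1)))) := rfl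
    rw [e, Nat.testBit_or, Bool.or_eq_true] at h
    rcases h with h | h
    · exact ih h
    · rw [Nat.testBit_shiftLeft, Bool.and_eq_true, decide_eq_true_eq] at h
      exact ⟨t, _, (Nat.sub_add_cancel h.1).symm, h.2⟩

def maskGood (M T : ℕ) : Bool := Nat.beq (T % 2 ^ M) (2 ^ M - 1)

lemma mask_check :
    maskGood 100000 (hexOr (hexOr (hexOr (hexOr 1 1 230) 1 230) 2 170) 4 120) = true := by
  decide +kernel

lemma mask_bits (M T n : ℕ) (h : maskGood M T = true) (hn : n < M) :
    T.testBit n = true := by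
  have h1 := Nat.eq_of_beq_eq_true h
  have h2 : (2 ^ M - 1).testBit n = true := by
    rw [Nat.testBit_two_pow_sub_one]; simpa using hn
  rw [← h1, Nat.testBit_mod_two_pow, Bool.and_eq_true] at h2
  exact h2.2

lemma small_case (n : ℕ) (hn : n < 100000) :
    ∃ x₁ x₂ x₃ x₄ : ℕ,
      n = x₁ * (2 * x₁ - 1) + x₂ * (2 * x₂ - 1)
          + 2 * (x₃ * (2 * x₃ - 1)) + 4 * (x₄ * (2 * x₄ - 1)) := by
  obtain ⟨x₄, j₄, h4, g4⟩ := hexOr_spec _ _ _ _ (mask_bits 100000 _ n mask_check hn)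
  obtain ⟨x₃, j₃, h3, g3⟩ := hexOr_spec _ _ _ _ g4
  obtain ⟨x₂, j₂, h2, g2⟩ := hexOr_spec _ _ _ _ g3
  obtain ⟨x₁, j₁, h1, g1⟩ := hexOr_spec _ _ _ _ g2
  have h0 : j₁ = 0 := by
    rcases j₁ with _ | j
    · rfl
    · rw [Nat.testBit_succ] at g1
      simp at g1
  exact ⟨x₁, x₂, x₃, x₄, by rw [h4, h3, h2, h1, h0]; ring⟩

theorem sum_hexagonal_1124 (n : ℕ) :
    ∃ x₁ x₂ x₃ x₄ : ℕ,
      n = x₁ * (2 * x₁ - 1) + x₂ * (2 * x₂ - 1)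
          + 2 * (x₃ * (2 * x₃ - 1)) + 4 * (x₄ * (2 * x₄ - 1)) := by
  rcases lt_or_ge n 100000 with h | h
  · exact small_case n h
  · exact large_case n h
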